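/- There exists η₀ > 0 such that for every η ∈ (0, η₀) there exists n₀ with the following property. Let H be a 3-graph on n ≥ n₀ vertices, let t = ⌊η·√(log₂(η²·n))⌋, let T be a tripartite cover of H all of whose members have class size exactly t with |V(T)| ≥ n/2, and let I = V ∖ V(T) satisfy |I| ≥ η²·n. If for at least η·C(|T|,2) unordered pairs {T_i, T_j} of distinct members of T the link graph L_ij either has a perfect matching or contains a copy of B₃₂₀, then H admits a tripartite cover T′ all of whose members have the same class size and with |V(T′)| ≥ |V(T)| + η³·n/8. -/

import Mathlib

attribute [local instance] Classical.propDecidable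

/-- The vertex set of a (candidate) complete 3-partite subgraph. -/
def triVerts {V : Type} [DecidableEq V] (p : Finset V × Finset V × Finset V) : Finset V :=
  p.1 ∪ p.2.1 ∪ p.2.2

/-- `p` is a complete 3-partite subgraph of the 3-graph `H`. -/
def IsCompleteTri {V : Type} [DecidableEq V] (H : Finset (Finset V))
    (p : Finset V × Finset V × Finset V) : Prop :=
  Disjoint p.1 p.2.1 ∧ Disjoint p.1 p.2.2 ∧ Disjoint p.2.1 p.2.2 ∧
    ∀ x ∈ p.1, ∀ y ∈ p.2.1, ∀ z ∈ p.2.2, ({x, y, z} : Finset V) ∈ H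

/-- `T` is a tripartite cover of `H`: a family of complete 3-partite subgraphs of `H`
with pairwise disjoint vertex sets. -/
def IsTriCover {V : Type} [DecidableEq V] (H : Finset (Finset V))
    (T : Finset (Finset V × Finset V × Finset V)) : Prop :=
  (∀ p ∈ T, IsCompleteTri H p) ∧
    (T : Set (Finset V × Finset V × Finset V)).Pairwise
      fun p q => Disjoint (triVerts p) (triVerts q)

/-- The set of vertices covered by a tripartite cover. -/
def coverVerts {V : Type} [DecidableEq V] (T : Finset (Finset V × Finset V × Finset V)) :
    Finset V :=
  T.biUnion triVerts

/-- The classes of a member, indexed by `Fin 3`. -/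
def cls {V : Type} (p : Finset V × Finset V × Finset V) : Fin 3 → Finset V :=
  ![p.1, p.2.1, p.2.2]

/-- `I` is connected to the pair of classes `(P, Q)`: the number of edges `{x,a,b}` of
`H` with `x ∈ I`, `a ∈ P`, `b ∈ Q` is at least `2η·|I|·|P|·|Q|`. -/
def ConnTo {V : Type} [DecidableEq V] (H : Finset (Finset V)) (I : Finset V) (η : ℝ)
    (P Q : Finset V) : Prop :=
  2 * η * I.card * P.card * Q.card ≤
    (((I ×ˢ P ×ˢ Q).filter fun w => ({w.1, w.2.1, w.2.2} : Finset V) ∈ H).card : ℝ)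

/-- The link graph `L_ij` of the pair `(p, q)` has a perfect matching. -/
def LinkPM {V : Type} [DecidableEq V] (H : Finset (Finset V)) (I : Finset V) (η : ℝ)
    (p q : Finset V × Finset V × Finset V) : Prop :=
  ∃ σ : Equiv.Perm (Fin 3), ∀ i : Fin 3, ConnTo H I η (cls p i) (cls q (σ i))

/-- The link graph `L_ij` of the pair `(p, q)` contains a copy of `B₃₂₀` (with the
degree-3 vertex on either side). -/
def LinkB320 {V : Type} [DecidableEq V] (H : Finset (Finset V)) (I : Finset V) (η : ℝ)
    (p q : Finset V × Finset V × Finset V) : Prop :=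
  ∃ f g : Fin 3 ≃ Fin 3,
    (ConnTo H I η (cls p (f 0)) (cls q (g 0)) ∧ ConnTo H I η (cls p (f 0)) (cls q (g 1)) ∧
      ConnTo H I η (cls p (f 0)) (cls q (g 2)) ∧ ConnTo H I η (cls p (f 1)) (cls q (g 0)) ∧
      ConnTo H I η (cls p (f 1)) (cls q (g 1))) ∨
    (ConnTo H I η (cls p (f 0)) (cls q (g 0)) ∧ ConnTo H I η (cls p (f 1)) (cls q (g 0)) ∧
      ConnTo H I η (cls p (f 2)) (cls q (g 0)) ∧ ConnTo H I η (cls p (f 0)) (cls q (g 1)) ∧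
      ConnTo H I η (cls p (f 1)) (cls q (g 1)))

/-- `H` has a matching of exactly `N` edges inside the vertex set `W`. -/
def HasMatching {V : Type} [DecidableEq V] (H : Finset (Finset V)) (W : Finset V) (N : ℕ) :
    Prop :=
  ∃ M ⊆ H, (M : Set (Finset V)).PairwiseDisjoint id ∧ (∀ e ∈ M, e ⊆ W) ∧ M.card = N

/-- `H` contains every transversal of the family `A`. -/
def IsTransversalComplete {V : Type} [DecidableEq V] (H : Finset (Finset V))
    (A : Fin 3 → Finset V) : Prop :=
  ∀ s : Fin 3 → V, (∀ i, s i ∈ A i) → Finset.univ.image s ∈ H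

section Matchings

variable {V : Type} [DecidableEq V] {H : Finset (Finset V)}

lemma HasMatching.empty (H : Finset (Finset V)) (W : Finset V) : HasMatching H W 0 :=
  ⟨∅, by simp, by simp, by simp, rfl⟩

lemma HasMatching.mono {W W' : Finset V} {N : ℕ} (h : HasMatching H W N) (hW : W ⊆ W') :
    HasMatching H W' N := by
  obtain ⟨M, hM, hd, hs, hc⟩ := h
  exact ⟨M, hM, hd, fun e he => (hs e he).trans hW, hc⟩

lemma HasMatching.of_le {W : Finset V} {N N' : ℕ} (h : HasMatching H W N) (hN : N' ≤ N) :
    HasMatching H W N' := by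
  obtain ⟨M, hM, hd, hs, hc⟩ := h
  obtain ⟨M', hM', hc'⟩ := Finset.exists_subset_card_eq (hN.trans hc.ge)
  exact ⟨M', hM'.trans hM, hd.subset (by exact_mod_cast hM'), fun e he => hs e (hM' he), hc'⟩

lemma HasMatching.singleton {e : Finset V} (he : e ∈ H) : HasMatching H e 1 :=
  ⟨{e}, by simpa using he, by simp, by simp, by simp⟩

lemma HasMatching.union (hH : ∀ e ∈ H, e.card = 3) {W W' : Finset V} {N N' : ℕ}
    (h : HasMatching H W N) (h' : HasMatching H W' N') (hW : Disjoint W W') :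
    HasMatching H (W ∪ W') (N + N') := by
  obtain ⟨M, hM, hd, hs, rfl⟩ := h
  obtain ⟨M', hM', hd', hs', rfl⟩ := h'
  refine ⟨M ∪ M', Finset.union_subset hM hM', ?_, ?_, Finset.card_union_of_disjoint ?_⟩
  · rw [Finset.coe_union, Set.pairwiseDisjoint_union]
    exact ⟨hd, hd', fun e he e' he' _ => hW.mono (hs e he) (hs' e' he')⟩
  · intro e he
    rcases Finset.mem_union.1 he with he | he
    · exact (hs e he).trans Finset.subset_union_left
    · exact (hs' e he).trans Finset.subset_union_right
  · rw [Finset.disjoint_left]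
    intro e he he'
    have h0 : e = ∅ := by
      simpa using hW (hs e he) (hs' e he')
    have := hH e (hM he)
    simp [h0] at this

lemma HasMatching.biUnion (hH : ∀ e ∈ H, e.card = 3) {ι : Type} (S : Finset ι)
    (W : ι → Finset V) (N : ℕ) (h : ∀ i ∈ S, HasMatching H (W i) N)
    (hW : (S : Set ι).PairwiseDisjoint W) :
    HasMatching H (S.biUnion W) (S.card * N) := by
  classical
  induction S using Finset.induction_on with
  | empty => simpa using HasMatching.empty H ∅
  | insert a S ha ih =>
    rw [Finset.biUnion_insert, Finset.card_insert_of_notMem ha, add_mul, one_mul, add_comm]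
    refine (h a (by simp)).union hH
      (ih (fun i hi => h i (by simp [hi])) (hW.subset (by simp))) ?_
    rw [Finset.disjoint_biUnion_right]
    intro i hi
    exact hW (by simp) (by simp [hi]) (by rintro rfl; exact ha hi)

lemma IsTransversalComplete.hasMatching (hH : ∀ e ∈ H, e.card = 3) (N : ℕ)
    {A : Fin 3 → Finset V} (hA : IsTransversalComplete H A)
    (hd : Pairwise fun i j => Disjoint (A i) (A j)) (hN : ∀ i, N ≤ (A i).card) :
    HasMatching H (Finset.univ.biUnion A) N := by
  induction N generalizing A with
  | zero => exact HasMatching.empty _ _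
  | succ N ih =>
    have hne : ∀ i, ∃ x, x ∈ A i := fun i =>
      Finset.card_pos.1 (lt_of_lt_of_le (Nat.succ_pos N) (hN i))
    choose s hs using hne
    have hsub : ∀ i, (A i).erase (s i) ⊆ A i := fun i => Finset.erase_subset _ _
    have h1 := ih (A := fun i => (A i).erase (s i)) (fun u hu => hA u fun i => hsub i (hu i))
      (fun i j hij => (hd hij).mono (hsub i) (hsub j))
      (fun i => by rw [Finset.card_erase_of_mem (hs i)]; have := hN i; omega)
    refine (h1.union hH (HasMatching.singleton (hA s hs)) ?_).mono ?_
    · rw [Finset.disjoint_left]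
      intro x hx hx'
      simp only [Finset.mem_biUnion, Finset.mem_univ, true_and, Finset.mem_erase] at hx
      obtain ⟨i, hxi, hxA⟩ := hx
      obtain ⟨j, -, rfl⟩ := Finset.mem_image.1 hx'
      by_cases hij : i = j
      · exact hxi (by rw [hij])
      · exact Finset.disjoint_left.1 (hd hij) hxA (hs j)
    · intro x hx
      rcases Finset.mem_union.1 hx with hx | hx
      · obtain ⟨i, -, hi⟩ := Finset.mem_biUnion.1 hx
        exact Finset.mem_biUnion.2 ⟨i, by simp, hsub i hi⟩
      · obtain ⟨j, -, rfl⟩ := Finset.mem_image.1 hx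
        exact Finset.mem_biUnion.2 ⟨j, by simp, hs j⟩

lemma HasMatching.exists_cover (hH : ∀ e ∈ H, e.card = 3) {W : Finset V} {N : ℕ}
    (h : HasMatching H W N) :
    ∃ T' : Finset (Finset V × Finset V × Finset V), IsTriCover H T' ∧
      (∀ p ∈ T', p.1.card = 1 ∧ p.2.1.card = 1 ∧ p.2.2.card = 1) ∧
      (coverVerts T').card = 3 * N := by
  obtain ⟨M, hM, hd, -, rfl⟩ := h
  have hex : ∀ e : Finset V, ∃ p : Finset V × Finset V × Finset V, e ∈ M →
      IsCompleteTri H p ∧ (p.1.card = 1 ∧ p.2.1.card = 1 ∧ p.2.2.card = 1) ∧ triVerts p = e := by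
    intro e
    by_cases he : e ∈ M
    · obtain ⟨x, y, z, hxy, hxz, hyz, rfl⟩ := Finset.card_eq_three.1 (hH e (hM he))
      refine ⟨({x}, {y}, {z}), fun _ => ⟨⟨by simpa, by simpa, by simpa, ?_⟩, by simp, ?_⟩⟩
      · simpa using hM he
      · ext; simp [triVerts]
    · exact ⟨(∅, ∅, ∅), fun h => absurd h he⟩
  choose F hF using hex
  refine ⟨M.image F, ⟨?_, ?_⟩, ?_, ?_⟩
  · intro p hp
    obtain ⟨e, he, rfl⟩ := Finset.mem_image.1 hp
    exact (hF e he).1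
  · intro p hp q hq hpq
    obtain ⟨e, he, rfl⟩ := Finset.mem_image.1 (Finset.mem_coe.1 hp)
    obtain ⟨e', he', rfl⟩ := Finset.mem_image.1 (Finset.mem_coe.1 hq)
    rw [(hF e he).2.2, (hF e' he').2.2]
    exact hd he he' (by rintro rfl; exact hpq rfl)
  · intro p hp
    obtain ⟨e, he, rfl⟩ := Finset.mem_image.1 hp
    exact (hF e he).2.1
  · have : coverVerts (M.image F) = M.biUnion id := by
      rw [coverVerts, Finset.image_biUnion]
      exact Finset.biUnion_congr rfl fun e he => (hF e he).2.2
    rw [this, Finset.card_biUnion (fun e he e' he' h => hd he he' h), mul_comm]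
    exact Finset.sum_const_nat fun e he => hH e (hM he)

/-- If `I` is connected to `(P, Q)`, then some edge with one vertex in each of `I`, `P`, `Q`
avoids a forbidden set that is small in all three. -/
lemma ConnTo.exists_edge_avoiding {I P Q F : Finset V} {η : ℝ} {t : ℕ}
    (h : ConnTo H I η P Q) (hP : P.card = t) (hQ : Q.card = t)
    (hFI : ((I ∩ F).card : ℝ) + 1 ≤ η * I.card)
    (hFP : 2 * (((P ∩ F).card : ℝ) + 1) ≤ η * t)
    (hFQ : 2 * (((Q ∩ F).card : ℝ) + 1) ≤ η * t) :
    ∃ x ∈ I \ F, ∃ a ∈ P \ F, ∃ b ∈ Q \ F, ({x, a, b} : Finset V) ∈ H := by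
  by_contra! hno
  unfold ConnTo at h
  have hsub : ((I ×ˢ P ×ˢ Q).filter fun w => ({w.1, w.2.1, w.2.2} : Finset V) ∈ H) ⊆
      (I ∩ F) ×ˢ P ×ˢ Q ∪ (I ×ˢ (P ∩ F) ×ˢ Q ∪ I ×ˢ P ×ˢ (Q ∩ F)) := by
    rintro ⟨x, a, b⟩ hw
    simp only [Finset.mem_filter, Finset.mem_product] at hw
    have := hno x
    simp only [Finset.mem_union, Finset.mem_product, Finset.mem_inter, Finset.mem_sdiff] at this ⊢
    by_contra! hcon
    exact this ⟨hw.1.1, by tauto⟩ a ⟨hw.1.2.1, by tauto⟩ b ⟨hw.1.2.2, by tauto⟩ hw.2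
  have hcard := (Finset.card_le_card hsub).trans ((Finset.card_union_le _ _).trans
    (Nat.add_le_add_left (Finset.card_union_le _ _) _))
  simp only [Finset.card_product, hP, hQ] at hcard
  rw [hP, hQ] at h
  have hcard' : 2 * η * I.card * t * t ≤ (I ∩ F).card * ((t : ℝ) * t) +
      (I.card * ((P ∩ F).card * (t : ℝ)) + I.card * ((t : ℝ) * (Q ∩ F).card)) :=
    h.trans (by exact_mod_cast hcard)
  have ht : (0 : ℝ) < t := by
    rcases Nat.eq_zero_or_pos t with h0 | h0
    · have : (0 : ℝ) ≤ (P ∩ F).card := Nat.cast_nonneg _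
      simp only [h0, Nat.cast_zero, mul_zero] at hFP
      linarith
    · exact_mod_cast h0
  have hI : (0 : ℝ) ≤ I.card := Nat.cast_nonneg _
  have e1 : (((I ∩ F).card : ℝ) + 1) * (t * t) ≤ η * I.card * (t * t) := by gcongr
  have e2 : 2 * (((P ∩ F).card : ℝ) + 1) * (I.card * t) ≤ η * t * (I.card * t) := by gcongr
  have e3 : 2 * (((Q ∩ F).card : ℝ) + 1) * (I.card * t) ≤ η * t * (I.card * t) := by gcongr
  have e4 : (0 : ℝ) ≤ I.card * t := by positivity
  have e5 : (0 : ℝ) < t * t := by positivity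
  nlinarith

/-- Greedy selection of one edge between `I` and each pair of classes in the list `L`. -/
lemma exists_greedy_matching (hH : ∀ e ∈ H, e.card = 3) {I U : Finset V} {A B : Fin 3 → Finset V}
    {η : ℝ} {t : ℕ} (hU : U ⊆ I)
    (hA : Pairwise fun i j => Disjoint (A i) (A j))
    (hB : Pairwise fun i j => Disjoint (B i) (B j)) (hAB : ∀ i j, Disjoint (A i) (B j))
    (hIA : ∀ i, Disjoint I (A i)) (hIB : ∀ i, Disjoint I (B i))
    (hAt : ∀ i, (A i).card = t) (hBt : ∀ i, (B i).card = t)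
    (L : List (Fin 3 × Fin 3)) (hL : ∀ w ∈ L, ConnTo H I η (A w.1) (B w.2))
    (hUL : (U.card : ℝ) + L.length ≤ η * I.card) (hLt : 2 * (L.length : ℝ) ≤ η * t) :
    ∃ X : Finset V, HasMatching H X L.length ∧
      X ⊆ (I \ U) ∪ (Finset.univ.biUnion A ∪ Finset.univ.biUnion B) ∧
      (I ∩ X).card ≤ L.length ∧
      (∀ i, (A i ∩ X).card ≤ (L.map Prod.fst).count i) ∧
      (∀ i, (B i ∩ X).card ≤ (L.map Prod.snd).count i) := by
  induction L with
  | nil => exact ⟨∅, HasMatching.empty _ _, by simp, by simp, by simp, by simp⟩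
  | cons w L ih =>
    obtain ⟨i, j⟩ := w
    rw [List.length_cons] at hUL hLt
    push_cast at hUL hLt
    obtain ⟨X, hX, hXs, hXI, hXA, hXB⟩ := ih (fun w hw => hL w (List.mem_cons_of_mem _ hw))
      (by linarith) (by linarith)
    have hUA : ∀ i, A i ∩ U = ∅ := fun i =>
      Finset.disjoint_iff_inter_eq_empty.1 ((hIA i).symm.mono_right hU)
    have hUB : ∀ i, B i ∩ U = ∅ := fun i =>
      Finset.disjoint_iff_inter_eq_empty.1 ((hIB i).symm.mono_right hU)
    have c1 : (I ∩ (U ∪ X)).card ≤ U.card + L.length := by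
      rw [Finset.inter_union_distrib_left]
      refine (Finset.card_union_le _ _).trans (Nat.add_le_add ?_ hXI)
      exact Finset.card_le_card Finset.inter_subset_right
    have c2 : (A i ∩ (U ∪ X)).card ≤ L.length := by
      rw [Finset.inter_union_distrib_left, hUA, Finset.empty_union]
      exact (hXA i).trans (List.count_le_length.trans (by simp))
    have c3 : (B j ∩ (U ∪ X)).card ≤ L.length := by
      rw [Finset.inter_union_distrib_left, hUB, Finset.empty_union]
      exact (hXB j).trans (List.count_le_length.trans (by simp))
    have c1' : ((I ∩ (U ∪ X)).card : ℝ) ≤ U.card + L.length := by exact_mod_cast c1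
    have c2' : ((A i ∩ (U ∪ X)).card : ℝ) ≤ L.length := by exact_mod_cast c2
    have c3' : ((B j ∩ (U ∪ X)).card : ℝ) ≤ L.length := by exact_mod_cast c3
    obtain ⟨x, hx, a, ha, b, hb, he⟩ := (hL (i, j) (by simp)).exists_edge_avoiding
      (F := U ∪ X) (hAt i) (hBt j) (by linarith) (by linarith) (by linarith)
    simp only [Finset.mem_sdiff, Finset.mem_union, not_or] at hx ha hb
    have key : ∀ (C : Finset V) (n : ℕ), (C ∩ X).card ≤ n →
        (C ∩ {x, a, b}).card ≤ 1 → (C ∩ (X ∪ {x, a, b})).card ≤ n + 1 := by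
      intro C n h1 h2
      rw [Finset.inter_union_distrib_left]
      exact (Finset.card_union_le _ _).trans (Nat.add_le_add h1 h2)
    have key0 : ∀ (C : Finset V) (n : ℕ), (C ∩ X).card ≤ n →
        (∀ y ∈ C, y ≠ x ∧ y ≠ a ∧ y ≠ b) → (C ∩ (X ∪ {x, a, b})).card ≤ n := by
      intro C n h1 h2
      refine le_trans (Finset.card_le_card ?_) h1
      intro y hy
      have := h2 y (Finset.mem_inter.1 hy).1
      simp only [Finset.mem_inter, Finset.mem_union, Finset.mem_insert,
        Finset.mem_singleton] at hy ⊢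
      tauto
    have single : ∀ (C : Finset V) (z : V), (∀ y ∈ C, y = x ∨ y = a ∨ y = b → y = z) →
        (C ∩ {x, a, b}).card ≤ 1 := by
      intro C z h1
      rw [← Finset.card_singleton z]
      refine Finset.card_le_card fun y hy => ?_
      simp only [Finset.mem_inter, Finset.mem_insert, Finset.mem_singleton] at hy ⊢
      exact h1 y hy.1 hy.2
    have nIA : ∀ i y, y ∈ I → y ∉ A i := fun i y => fun h => Finset.disjoint_left.1 (hIA i) h
    have nIB : ∀ i y, y ∈ I → y ∉ B i := fun i y => fun h => Finset.disjoint_left.1 (hIB i) h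
    have nAB : ∀ i j y, y ∈ A i → y ∉ B j := fun i j y => fun h => Finset.disjoint_left.1 (hAB i j) h
    have nA : ∀ k, i ≠ k → ∀ y, y ∈ A i → y ∉ A k := fun k hk y => fun h =>
      Finset.disjoint_left.1 (hA hk) h
    have nB : ∀ k, j ≠ k → ∀ y, y ∈ B j → y ∉ B k := fun k hk y => fun h =>
      Finset.disjoint_left.1 (hB hk) h
    refine ⟨X ∪ {x, a, b}, hX.union hH (HasMatching.singleton he) ?_, ?_, ?_, ?_, ?_⟩
    · simp only [Finset.disjoint_insert_right, Finset.disjoint_singleton_right]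
      tauto
    · refine Finset.union_subset hXs ?_
      intro y hy
      simp only [Finset.mem_insert, Finset.mem_singleton] at hy
      simp only [Finset.mem_union, Finset.mem_sdiff, Finset.mem_biUnion, Finset.mem_univ, true_and]
      rcases hy with rfl | rfl | rfl
      · exact Or.inl ⟨hx.1, hx.2.1⟩
      · exact Or.inr (Or.inl ⟨i, ha.1⟩)
      · exact Or.inr (Or.inr ⟨j, hb.1⟩)
    · refine key I _ hXI (single I x ?_)
      rintro y hy (rfl | rfl | rfl)
      · rfl
      · exact absurd ha.1 (nIA i _ hy)
      · exact absurd hb.1 (nIB j _ hy)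
    · intro k
      rw [List.map_cons, List.count_cons]
      by_cases hk : i = k
      · subst hk
        simp only [beq_self_eq_true, if_true]
        refine key _ _ (hXA i) (single _ a ?_)
        rintro y hy (rfl | rfl | rfl)
        · exact absurd hy (nIA i _ hx.1)
        · rfl
        · exact absurd hb.1 (nAB i j _ hy)
      · simp only [beq_iff_eq, hk, if_false, add_zero]
        refine key0 _ _ (hXA k) fun y hy => ⟨?_, ?_, ?_⟩
        · rintro rfl; exact nIA k _ hx.1 hy
        · rintro rfl; exact nA k hk _ ha.1 hy
        · rintro rfl; exact nAB k j _ hy hb.1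
    · intro k
      rw [List.map_cons, List.count_cons]
      by_cases hk : j = k
      · subst hk
        simp only [beq_self_eq_true, if_true]
        refine key _ _ (hXB j) (single _ b ?_)
        rintro y hy (rfl | rfl | rfl)
        · exact absurd hy (nIB j _ hx.1)
        · exact absurd hy (nAB i j _ ha.1)
        · rfl
      · simp only [beq_iff_eq, hk, if_false, add_zero]
        refine key0 _ _ (hXB k) fun y hy => ⟨?_, ?_, ?_⟩
        · rintro rfl; exact nIB k _ hx.1 hy
        · rintro rfl; exact nAB i k _ ha.1 hy
        · rintro rfl; exact nB k hk _ hb.1 hy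

/-- Two complete tripartite graphs, together with a list `L` of connected pairs of classes that
uses each class of `A` at most `α` times and each class of `B` at most `β` times, span with `I`
a matching that gains `L.length - α - β` edges. -/
lemma exists_matching_of_list (hH : ∀ e ∈ H, e.card = 3) {I U : Finset V}
    {A B : Fin 3 → Finset V} {η : ℝ} {t : ℕ} (hU : U ⊆ I)
    (hAc : IsTransversalComplete H A) (hBc : IsTransversalComplete H B)
    (hA : Pairwise fun i j => Disjoint (A i) (A j))
    (hB : Pairwise fun i j => Disjoint (B i) (B j)) (hAB : ∀ i j, Disjoint (A i) (B j))
    (hIA : ∀ i, Disjoint I (A i)) (hIB : ∀ i, Disjoint I (B i))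
    (hAt : ∀ i, (A i).card = t) (hBt : ∀ i, (B i).card = t)
    (L : List (Fin 3 × Fin 3)) (hL : ∀ w ∈ L, ConnTo H I η (A w.1) (B w.2))
    (hUL : (U.card : ℝ) + L.length ≤ η * I.card) (hLt : 2 * (L.length : ℝ) ≤ η * t)
    {α β R : ℕ} (hα : ∀ i, (L.map Prod.fst).count i ≤ α)
    (hβ : ∀ i, (L.map Prod.snd).count i ≤ β) (hαt : α ≤ t) (hβt : β ≤ t)
    (hLR : α + β + R ≤ L.length) :
    ∃ Y : Finset V, Y ⊆ I \ U ∧ Y.card ≤ L.length ∧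
      HasMatching H (Y ∪ (Finset.univ.biUnion A ∪ Finset.univ.biUnion B)) (2 * t + R) := by
  obtain ⟨X, hX, hXs, hXI, hXA, hXB⟩ :=
    exists_greedy_matching hH hU hA hB hAB hIA hIB hAt hBt L hL hUL hLt
  have h1 : HasMatching H (Finset.univ.biUnion fun i => A i \ X) (t - α) := by
    refine IsTransversalComplete.hasMatching hH _
      (fun s hs => hAc s fun i => (Finset.mem_sdiff.1 (hs i)).1)
      (fun i j hij => (hA hij).mono Finset.sdiff_subset Finset.sdiff_subset) fun i => ?_
    have e1 := Finset.card_sdiff_add_card_inter (A i) X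
    have e2 := hXA i
    have e3 := hα i
    have e4 := hAt i
    omega
  have h2 : HasMatching H (Finset.univ.biUnion fun i => B i \ X) (t - β) := by
    refine IsTransversalComplete.hasMatching hH _
      (fun s hs => hBc s fun i => (Finset.mem_sdiff.1 (hs i)).1)
      (fun i j hij => (hB hij).mono Finset.sdiff_subset Finset.sdiff_subset) fun i => ?_
    have e1 := Finset.card_sdiff_add_card_inter (B i) X
    have e2 := hXB i
    have e3 := hβ i
    have e4 := hBt i
    omega
  have h12 := h1.union hH h2 (by
    simp only [Finset.disjoint_biUnion_left, Finset.disjoint_biUnion_right]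
    exact fun i _ j _ => (hAB j i).mono Finset.sdiff_subset Finset.sdiff_subset)
  have h3 := hX.union hH h12 (by
    simp only [Finset.disjoint_union_right, Finset.disjoint_biUnion_right]
    exact ⟨fun i _ => Finset.disjoint_sdiff, fun i _ => Finset.disjoint_sdiff⟩)
  refine ⟨X ∩ (I \ U), Finset.inter_subset_right, le_trans (Finset.card_le_card ?_) hXI,
    (h3.of_le (by omega)).mono ?_⟩
  · intro y hy
    simp only [Finset.mem_inter, Finset.mem_sdiff] at hy ⊢
    tauto
  · intro y hy
    simp only [Finset.mem_union] at hy
    rcases hy with hy | hy | hy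
    · have := hXs hy
      simp only [Finset.mem_union, Finset.mem_inter] at this ⊢
      tauto
    · obtain ⟨i, -, hi⟩ := Finset.mem_biUnion.1 hy
      exact Finset.mem_union_right _ (Finset.mem_union_left _
        (Finset.mem_biUnion.2 ⟨i, by simp, (Finset.mem_sdiff.1 hi).1⟩))
    · obtain ⟨i, -, hi⟩ := Finset.mem_biUnion.1 hy
      exact Finset.mem_union_right _ (Finset.mem_union_right _
        (Finset.mem_biUnion.2 ⟨i, by simp, (Finset.mem_sdiff.1 hi).1⟩))

end Matchings

section Members

variable {V : Type} [DecidableEq V] {H : Finset (Finset V)}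
  {p q : Finset V × Finset V × Finset V}

lemma biUnion_cls_comp (p : Finset V × Finset V × Finset V) (f : Equiv.Perm (Fin 3)) :
    Finset.univ.biUnion (fun i => cls p (f i)) = triVerts p := by
  have h : Finset.univ.biUnion (fun i => cls p (f i)) = Finset.univ.biUnion (cls p) := by
    ext x
    simp only [Finset.mem_biUnion, Finset.mem_univ, true_and]
    exact ⟨fun ⟨i, hi⟩ => ⟨f i, hi⟩, fun ⟨i, hi⟩ => ⟨f.symm i, by simpa using hi⟩⟩
  rw [h]
  ext x
  simp [cls, triVerts, Fin.exists_fin_succ]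

lemma cls_subset_triVerts (p : Finset V × Finset V × Finset V) (i : Fin 3) :
    cls p i ⊆ triVerts p := by
  rw [← biUnion_cls_comp p (Equiv.refl _)]
  exact Finset.subset_biUnion_of_mem (fun i => cls p (Equiv.refl _ i)) (Finset.mem_univ i)

lemma IsCompleteTri.pairwise_disjoint_cls (h : IsCompleteTri H p) :
    Pairwise fun i j => Disjoint (cls p i) (cls p j) := by
  obtain ⟨h1, h2, h3, -⟩ := h
  intro i j hij
  fin_cases i <;> fin_cases j <;> simp_all [cls, disjoint_comm]

lemma IsCompleteTri.isTransversalComplete (h : IsCompleteTri H p) (f : Equiv.Perm (Fin 3)) :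
    IsTransversalComplete H fun i => cls p (f i) := by
  intro s hs
  have hs' : ∀ i, s (f.symm i) ∈ cls p i := fun i => by simpa using hs (f.symm i)
  have := h.2.2.2 _ (hs' 0) _ (hs' 1) _ (hs' 2)
  convert this using 1
  ext x
  simp only [Finset.mem_image, Finset.mem_univ, true_and, Finset.mem_insert,
    Finset.mem_singleton]
  constructor
  · rintro ⟨i, rfl⟩
    obtain ⟨j, rfl⟩ := f.symm.surjective i
    fin_cases j <;> simp
  · rintro (rfl | rfl | rfl) <;> exact ⟨_, rfl⟩

lemma IsCompleteTri.hasMatching (hH : ∀ e ∈ H, e.card = 3) (h : IsCompleteTri H p) {t : ℕ}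
    (ht : ∀ i, (cls p i).card = t) : HasMatching H (triVerts p) t := by
  rw [← biUnion_cls_comp p (Equiv.refl _)]
  exact (h.isTransversalComplete (Equiv.refl _)).hasMatching hH t h.pairwise_disjoint_cls
    fun i => (ht i).ge

/-- A pair of members whose link graph has a perfect matching or a `B₃₂₀` can be rematched
with a gain of `R` edges, using at most `6 * R` vertices of `I \ U`. -/
lemma exists_matching_of_link (hH : ∀ e ∈ H, e.card = 3) {I U : Finset V} {η : ℝ} {t R : ℕ}
    (hU : U ⊆ I) (hp : IsCompleteTri H p) (hq : IsCompleteTri H q)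
    (hpq : Disjoint (triVerts p) (triVerts q))
    (hIp : Disjoint I (triVerts p)) (hIq : Disjoint I (triVerts q))
    (hpt : ∀ i, (cls p i).card = t) (hqt : ∀ i, (cls q i).card = t)
    (hUR : (U.card : ℝ) + 6 * R ≤ η * I.card) (hRt : 12 * (R : ℝ) ≤ η * t) (hRt' : 3 * R ≤ t)
    (hlink : LinkPM H I η p q ∨ LinkB320 H I η p q) :
    ∃ Y : Finset V, Y ⊆ I \ U ∧ Y.card ≤ 6 * R ∧
      HasMatching H (Y ∪ (triVerts p ∪ triVerts q)) (2 * t + R) := by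
  have key : ∀ (f g : Equiv.Perm (Fin 3)) (L : List (Fin 3 × Fin 3)) (α β : ℕ),
      (∀ w ∈ L, ConnTo H I η (cls p (f w.1)) (cls q (g w.2))) → L.length ≤ 6 * R →
      (∀ i, (L.map Prod.fst).count i ≤ α) → (∀ i, (L.map Prod.snd).count i ≤ β) →
      α ≤ t → β ≤ t → α + β + R ≤ L.length →
      ∃ Y : Finset V, Y ⊆ I \ U ∧ Y.card ≤ 6 * R ∧
        HasMatching H (Y ∪ (triVerts p ∪ triVerts q)) (2 * t + R) := by
    intro f g L α β hL hlen hα hβ hαt hβt hLR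
    have hlen' : (L.length : ℝ) ≤ 6 * R := by exact_mod_cast hlen
    obtain ⟨Y, hY, hYc, hM⟩ := exists_matching_of_list hH hU (hp.isTransversalComplete f)
      (hq.isTransversalComplete g)
      (fun i j hij => hp.pairwise_disjoint_cls (f.injective.ne hij))
      (fun i j hij => hq.pairwise_disjoint_cls (g.injective.ne hij))
      (fun i j => hpq.mono (cls_subset_triVerts p _) (cls_subset_triVerts q _))
      (fun i => hIp.mono_right (cls_subset_triVerts p _))
      (fun i => hIq.mono_right (cls_subset_triVerts q _))
      (fun i => hpt _) (fun i => hqt _) L hL (by linarith) (by linarith) hα hβ hαt hβt hLR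
    rw [biUnion_cls_comp, biUnion_cls_comp] at hM
    exact ⟨Y, hY, hYc.trans hlen, hM⟩
  rcases hlink with ⟨σ, hσ⟩ | ⟨f, g, ⟨h1, h2, h3, h4, h5⟩ | ⟨h1, h2, h3, h4, h5⟩⟩
  · refine key (Equiv.refl _) σ
      (List.replicate R (0, 0) ++ List.replicate R (1, 1) ++ List.replicate R (2, 2)) R R
      ?_ ?_ ?_ ?_ (by omega) (by omega) ?_
    · intro w hw
      simp only [List.mem_append, List.mem_replicate] at hw
      rcases hw with (⟨-, rfl⟩ | ⟨-, rfl⟩) | ⟨-, rfl⟩ <;> exact hσ _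
    · simp; omega
    · intro i
      fin_cases i <;> simp [List.count_replicate]
    · intro i
      fin_cases i <;> simp [List.count_replicate]
    · simp; omega
  · refine key f g (List.replicate R (0, 0) ++ List.replicate (2 * R) (0, 2) ++
      List.replicate R (1, 0) ++ List.replicate (2 * R) (1, 1)) (3 * R) (2 * R)
      ?_ ?_ ?_ ?_ (by omega) (by omega) ?_
    · intro w hw
      simp only [List.mem_append, List.mem_replicate] at hw
      rcases hw with ((⟨-, rfl⟩ | ⟨-, rfl⟩) | ⟨-, rfl⟩) | ⟨-, rfl⟩ <;> assumption
    · simp; omega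
    · intro i
      fin_cases i <;> simp [List.count_replicate] <;> omega
    · intro i
      fin_cases i <;> simp [List.count_replicate]
      omega
    · simp; omega
  · refine key f g (List.replicate R (0, 0) ++ List.replicate (2 * R) (2, 0) ++
      List.replicate R (0, 1) ++ List.replicate (2 * R) (1, 1)) (2 * R) (3 * R)
      ?_ ?_ ?_ ?_ (by omega) (by omega) ?_
    · intro w hw
      simp only [List.mem_append, List.mem_replicate] at hw
      rcases hw with ((⟨-, rfl⟩ | ⟨-, rfl⟩) | ⟨-, rfl⟩) | ⟨-, rfl⟩ <;> assumption
    · simp; omega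
    · intro i
      fin_cases i <;> simp [List.count_replicate]
      omega
    · intro i
      fin_cases i <;> simp [List.count_replicate] <;> omega
    · simp; omega

end Members

/-- A set of more than `2 * |S| * |T|` ordered pairs in `T` contains a pair avoiding `S`. -/
lemma exists_pair_avoiding {α : Type} [DecidableEq α] {T S : Finset α} {G : Finset (α × α)}
    (hG : G ⊆ T ×ˢ T) (hc : 2 * (S.card * T.card) < G.card) :
    ∃ w ∈ G, w.1 ∉ S ∧ w.2 ∉ S := by
  by_contra! hno
  have hsub : G ⊆ S ×ˢ T ∪ T ×ˢ S := by
    rintro ⟨a, b⟩ hw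
    have h1 := hno _ hw
    have h2 := hG hw
    simp only [Finset.mem_union, Finset.mem_product] at h1 h2 ⊢
    tauto
  have := (Finset.card_le_card hsub).trans (Finset.card_union_le _ _)
  simp only [Finset.card_product] at this
  nlinarith

section Cover

variable {V : Type} [DecidableEq V] {H : Finset (Finset V)}
  {T : Finset (Finset V × Finset V × Finset V)}

/-- Rematching `k` disjoint linked pairs of members of a tripartite cover. -/
lemma exists_matching_of_linked_pairs (hH : ∀ e ∈ H, e.card = 3) (hT : IsTriCover H T)
    {I : Finset V} (hI : ∀ p ∈ T, Disjoint I (triVerts p)) {η : ℝ} {t R K : ℕ}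
    (ht : ∀ p ∈ T, ∀ i, (cls p i).card = t)
    (hRK : 6 * (R : ℝ) * K ≤ η * I.card) (hRt : 12 * (R : ℝ) ≤ η * t) (hRt' : 3 * R ≤ t)
    (hpairs : 4 * (K * T.card) <
      (T.offDiag.filter fun w => LinkPM H I η w.1 w.2 ∨ LinkB320 H I η w.1 w.2).card + 4 * T.card)
    (k : ℕ) (hk : k ≤ K) :
    ∃ S ⊆ T, S.card = 2 * k ∧ ∃ X ⊆ I, X.card ≤ 6 * R * k ∧
      HasMatching H (X ∪ S.biUnion triVerts) (2 * k * t + R * k) := by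
  classical
  induction k with
  | zero => exact ⟨∅, by simp, rfl, ∅, by simp, by simp,
      by simpa using HasMatching.empty H _⟩
  | succ k ih =>
    obtain ⟨S, hST, hSc, X, hXI, hXc, hM⟩ := ih (by omega)
    obtain ⟨⟨p, q⟩, hw, hpS, hqS⟩ := exists_pair_avoiding (T := T) (S := S)
      (G := T.offDiag.filter fun w => LinkPM H I η w.1 w.2 ∨ LinkB320 H I η w.1 w.2)
      (fun w hw => by
        have := Finset.mem_offDiag.1 (Finset.mem_filter.1 hw).1
        exact Finset.mem_product.2 ⟨this.1, this.2.1⟩)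
      (by
        have := Nat.mul_le_mul_right T.card hk
        rw [hSc]
        nlinarith)
    simp only [Finset.mem_filter, Finset.mem_offDiag] at hw hpS hqS
    obtain ⟨⟨hp, hq, hne⟩, hlink⟩ := hw
    have hkK : (k : ℝ) + 1 ≤ K := by exact_mod_cast hk
    have hXc' : (X.card : ℝ) ≤ 6 * R * k := by exact_mod_cast hXc
    obtain ⟨Y, hY, hYc, hYM⟩ := exists_matching_of_link hH hXI (hT.1 p hp) (hT.1 q hq)
      (hT.2 hp hq hne) (hI p hp) (hI q hq) (ht p hp) (ht q hq)
      (by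
        have : 6 * (R : ℝ) * (k + 1) ≤ 6 * R * K := by gcongr
        linarith) hRt hRt' hlink
    have hpqS : p ∉ insert q S := by simp [hne, hpS]
    refine ⟨insert p (insert q S), ?_, ?_, X ∪ Y, ?_, ?_, ?_⟩
    · simp [Finset.insert_subset_iff, hp, hq, hST]
    · rw [Finset.card_insert_of_notMem hpqS, Finset.card_insert_of_notMem hqS]; omega
    · exact Finset.union_subset hXI (hY.trans Finset.sdiff_subset)
    · refine (Finset.card_union_le _ _).trans ?_
      linarith
    · have hd : Disjoint (X ∪ S.biUnion triVerts) (Y ∪ (triVerts p ∪ triVerts q)) := by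
        have hYI : Y ⊆ I := hY.trans Finset.sdiff_subset
        have e1 : Disjoint X Y := (Finset.disjoint_sdiff (s := X) (t := I)).mono_right hY
        refine Finset.disjoint_union_left.2 ⟨?_, (Finset.disjoint_biUnion_left _ _ _).2 ?_⟩
        · simp only [Finset.disjoint_union_right]
          exact ⟨e1, (hI p hp).mono_left hXI, (hI q hq).mono_left hXI⟩
        intro r hr
        simp only [Finset.disjoint_union_right]
        refine ⟨((hI r (hST hr)).mono_left hYI).symm, ?_, ?_⟩
        · exact hT.2 (hST hr) hp (by rintro rfl; exact hpS hr)
        · exact hT.2 (hST hr) hq (by rintro rfl; exact hqS hr)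
      refine ((hM.union hH hYM hd).of_le (by linarith)).mono ?_
      intro y hy
      simp only [Finset.biUnion_insert, Finset.mem_union] at hy ⊢
      tauto

lemma exists_cover_of_linked_pairs (hH : ∀ e ∈ H, e.card = 3) (hT : IsTriCover H T)
    {I : Finset V} (hI : ∀ p ∈ T, Disjoint I (triVerts p)) {η : ℝ} {t R K : ℕ}
    (ht : ∀ p ∈ T, ∀ i, (cls p i).card = t)
    (hRK : 6 * (R : ℝ) * K ≤ η * I.card) (hRt : 12 * (R : ℝ) ≤ η * t) (hRt' : 3 * R ≤ t)
    (hpairs : 4 * (K * T.card) <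
      (T.offDiag.filter fun w => LinkPM H I η w.1 w.2 ∨ LinkB320 H I η w.1 w.2).card + 4 * T.card) :
    ∃ T' : Finset (Finset V × Finset V × Finset V), IsTriCover H T' ∧
      (∀ p ∈ T', p.1.card = 1 ∧ p.2.1.card = 1 ∧ p.2.2.card = 1) ∧
      (coverVerts T').card = 3 * (T.card * t + R * K) := by
  obtain ⟨S, hST, hSc, X, hXI, -, hM⟩ :=
    exists_matching_of_linked_pairs hH hT hI ht hRK hRt hRt' hpairs K le_rfl
  have hrest := HasMatching.biUnion hH (T \ S) triVerts t
    (fun p hp => (hT.1 p (Finset.sdiff_subset hp)).hasMatching hH (ht p (Finset.sdiff_subset hp)))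
    (fun p hp q hq h => hT.2 (Finset.sdiff_subset hp) (Finset.sdiff_subset hq) h)
  have hall := hM.union hH hrest (by
    refine (Finset.disjoint_biUnion_right _ _ _).2 fun p hp => Finset.disjoint_union_left.2
      ⟨(hI p (Finset.sdiff_subset hp)).mono_left hXI,
        (Finset.disjoint_biUnion_left _ _ _).2 fun q hq => ?_⟩
    have hp' := Finset.mem_sdiff.1 hp
    exact hT.2 (hST hq) hp'.1 (by rintro rfl; exact hp'.2 hq))
  have hcard := Finset.card_sdiff_add_card_eq_card hST
  refine (hall.of_le (le_of_eq ?_)).exists_cover hH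
  rw [← hcard, hSc]
  ring

lemma card_coverVerts_le {t : ℕ} (ht : ∀ p ∈ T, ∀ i, (cls p i).card = t) :
    (coverVerts T).card ≤ 3 * (T.card * t) := by
  refine (Finset.card_biUnion_le_card_mul _ _ (3 * t) fun p hp => ?_).trans (by linarith)
  rw [← biUnion_cls_comp p (Equiv.refl _)]
  refine (Finset.card_biUnion_le_card_mul _ _ t fun i _ => (ht p hp _).le).trans (by simp)

end Cover

lemma eventually_class_size_bounds {η : ℝ} (hη : 0 < η) {C c : ℝ} (hc : 0 < c) :
    ∃ n₀ : ℕ, ∀ n : ℕ, n₀ ≤ n →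
      C ≤ (⌊η * Real.sqrt (Real.logb 2 (η ^ 2 * n))⌋₊ : ℝ) ∧
      (⌊η * Real.sqrt (Real.logb 2 (η ^ 2 * n))⌋₊ : ℝ) ≤ c * n := by
  rw [← Filter.eventually_atTop]
  have hy : Filter.Tendsto (fun n : ℕ => η ^ 2 * (n : ℝ)) Filter.atTop Filter.atTop :=
    tendsto_natCast_atTop_atTop.const_mul_atTop (by positivity)
  have hlog : Filter.Tendsto (fun n : ℕ => Real.logb 2 (η ^ 2 * n)) Filter.atTop Filter.atTop :=
    (Real.tendsto_logb_atTop (by norm_num)).comp hy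
  have h1 : Filter.Tendsto (fun n : ℕ => η * Real.sqrt (Real.logb 2 (η ^ 2 * n)))
      Filter.atTop Filter.atTop := (Real.tendsto_sqrt_atTop.comp hlog).const_mul_atTop hη
  have hε : 0 < c * Real.log 2 / η ^ 3 := by positivity
  have h2 := hy.eventually (Real.isLittleO_log_id_atTop.bound hε)
  filter_upwards [h1.eventually_ge_atTop (C + 1), h2, hlog.eventually_ge_atTop 1,
    hy.eventually_ge_atTop 1] with n hn1 hn2 hn3 hn4
  refine ⟨?_, ?_⟩
  · have := Nat.lt_floor_add_one (η * Real.sqrt (Real.logb 2 (η ^ 2 * n)))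
    linarith
  · refine (Nat.floor_le (by positivity)).trans ?_
    have e1 : Real.sqrt (Real.logb 2 (η ^ 2 * n)) ≤ Real.logb 2 (η ^ 2 * n) := by
      rw [Real.sqrt_le_left (by linarith)]
      nlinarith
    have e2 : Real.log (η ^ 2 * n) ≤ c * Real.log 2 / η ^ 3 * (η ^ 2 * n) := by
      simp only [Real.norm_eq_abs, id] at hn2
      rw [abs_of_nonneg (by linarith : (0 : ℝ) ≤ η ^ 2 * n)] at hn2
      exact (le_abs_self _).trans hn2
    calc η * Real.sqrt (Real.logb 2 (η ^ 2 * n))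
        ≤ η * Real.logb 2 (η ^ 2 * n) := by gcongr
      _ ≤ η * ((c * Real.log 2 / η ^ 3 * (η ^ 2 * n)) / Real.log 2) := by
          rw [Real.logb]; gcongr
      _ = c * n := by
          have : Real.log 2 ≠ 0 := by positivity
          field_simp

/-- The choice of the gain `R` per pair and of the number `K` of pairs. -/
lemma exists_gain_parameters {η n t m : ℝ} (hη : 0 < η) (hη' : η < 1 / 48) (ht : 24 / η ≤ t)
    (htn : t ≤ η ^ 2 * n) (hm : n / 2 ≤ 3 * (m * t)) :
    ∃ R K : ℕ, 12 * (R : ℝ) ≤ η * t ∧ 6 * (R : ℝ) * K ≤ η ^ 3 * n ∧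
      η ^ 3 * n / 8 ≤ 3 * (R * K) ∧ 4 * (K : ℝ) < η * (m - 1) + 4 := by
  have hηt : 24 ≤ η * t := by rwa [div_le_iff₀' hη] at ht
  have htpos : 0 < t := lt_of_lt_of_le (by positivity) ht
  have hn : 0 < n := by
    by_contra! hcon
    nlinarith [mul_nonneg (sq_nonneg η) (neg_nonneg.2 hcon)]
  obtain ⟨R, hR⟩ : ∃ R : ℕ, R = ⌊η * t / 12⌋₊ := ⟨_, rfl⟩
  have hR1 : (R : ℝ) ≤ η * t / 12 := hR ▸ Nat.floor_le (by positivity)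
  have hR2 : η * t / 24 ≤ R := by
    have := hR ▸ Nat.lt_floor_add_one (η * t / 12)
    linarith
  have hRpos : (0 : ℝ) < R := lt_of_lt_of_le (by positivity) hR2
  obtain ⟨K, hK⟩ : ∃ K : ℕ, K = ⌈η ^ 3 * n / (24 * R)⌉₊ := ⟨_, rfl⟩
  have hK1 : η ^ 3 * n / (24 * R) ≤ K := hK ▸ Nat.le_ceil _
  have hK2 : (K : ℝ) < η ^ 3 * n / (24 * R) + 1 := hK ▸ Nat.ceil_lt_add_one (by positivity)
  have hcancel : η ^ 3 * n / (24 * R) * R = η ^ 3 * n / 24 := by field_simp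
  have htn' : η * t ≤ η ^ 3 * n := by
    calc η * t ≤ η * (η ^ 2 * n) := by gcongr
      _ = η ^ 3 * n := by ring
  have hK1' := mul_le_mul_of_nonneg_right hK1 hRpos.le
  have hK2' := mul_le_mul_of_nonneg_right hK2.le hRpos.le
  have hpos : 0 ≤ η ^ 3 * n := by positivity
  refine ⟨R, K, by linarith, by linarith, by linarith, ?_⟩
  have h1 : η ^ 3 * n / (24 * R) ≤ η ^ 2 * (n / t) := by
    calc η ^ 3 * n / (24 * R) ≤ η ^ 3 * n / (24 * (η * t / 24)) := by gcongr
      _ = η ^ 2 * (n / t) := by field_simp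
  have h2 : n / t ≤ 6 * m := by
    rw [div_le_iff₀ htpos]
    linarith
  have h3 : 12 ≤ n / t := by
    rw [le_div_iff₀ htpos]
    have : η ^ 2 * n ≤ (1 / 48) ^ 2 * n := by gcongr
    linarith
  have h4 : η * (η * (n / t)) ≤ 1 / 48 * (η * (n / t)) := by gcongr
  have h5 : η * (n / t) ≤ η * (6 * m) := by gcongr
  have h6 : η * 12 ≤ η * (n / t) := by gcongr
  linarith

/-- Claim: if for at least `η·C(|T|,2)` unordered pairs of distinct members of the cover
the link graph has a perfect matching or contains a `B₃₂₀` (equivalently, at least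
`2η·C(|T|,2)` ordered pairs, since the condition is symmetric), then the cover can be
enlarged by at least `η³n/8` vertices, keeping all members balanced of a common size. -/
theorem stmt12 :
    ∃ η₀ : ℝ, 0 < η₀ ∧ ∀ η : ℝ, 0 < η → η < η₀ →
    ∃ n₀ : ℕ, ∀ n : ℕ, n₀ ≤ n →
    ∀ (V : Type) [Fintype V] [DecidableEq V], Fintype.card V = n →
    ∀ H : Finset (Finset V), (∀ e ∈ H, e.card = 3) →
    ∀ T : Finset (Finset V × Finset V × Finset V), IsTriCover H T →
    ∀ t : ℕ, t = ⌊η * Real.sqrt (Real.logb 2 (η ^ 2 * n))⌋₊ →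
    (∀ p ∈ T, p.1.card = t ∧ p.2.1.card = t ∧ p.2.2.card = t) →
    (n : ℝ) / 2 ≤ ((coverVerts T).card : ℝ) →
    ∀ I : Finset V, I = Finset.univ \ coverVerts T →
    η ^ 2 * n ≤ (I.card : ℝ) →
    2 * η * (T.card.choose 2 : ℝ) ≤
      ((T.offDiag.filter fun pq => LinkPM H I η pq.1 pq.2 ∨ LinkB320 H I η pq.1 pq.2).card : ℝ) →
    ∃ T' : Finset (Finset V × Finset V × Finset V), IsTriCover H T' ∧
      (∃ t' : ℕ, ∀ p ∈ T', p.1.card = t' ∧ p.2.1.card = t' ∧ p.2.2.card = t') ∧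
      ((coverVerts T).card : ℝ) + η ^ 3 * n / 8 ≤ ((coverVerts T').card : ℝ) := by
  refine ⟨1 / 48, by norm_num, fun η hη hη' => ?_⟩
  obtain ⟨n₀, hn₀⟩ := eventually_class_size_bounds hη (C := 24 / η) (c := η ^ 2)
    (by positivity)
  refine ⟨n₀, fun n hn V _ _ hV H hH T hT t htdef ht hcov I hIdef hIc hpairs => ?_⟩
  obtain ⟨htl, htu⟩ := hn₀ n hn
  rw [← htdef] at htl htu
  have ht' : ∀ p ∈ T, ∀ i, (cls p i).card = t := by
    intro p hp i
    obtain ⟨h1, h2, h3⟩ := ht p hp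
    fin_cases i
    exacts [h1, h2, h3]
  have hle := card_coverVerts_le ht'
  have hle' : ((coverVerts T).card : ℝ) ≤ 3 * (T.card * t) := by exact_mod_cast hle
  obtain ⟨R, K, hRt, hRK, hgain, hK⟩ :=
    exists_gain_parameters hη hη' htl htu (hcov.trans hle')
  have hI : ∀ p ∈ T, Disjoint I (triVerts p) := by
    intro p hp
    rw [hIdef]
    exact Finset.sdiff_disjoint.mono_right (Finset.subset_biUnion_of_mem triVerts hp)
  have htpos : (0 : ℝ) < t := lt_of_lt_of_le (by positivity) htl
  have hRt' : 3 * R ≤ t := by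
    have : 3 * (R : ℝ) ≤ t := by nlinarith
    exact_mod_cast this
  have hTpos : (0 : ℝ) < T.card := by
    have hnpos : (0 : ℝ) < n := by
      by_contra hcon
      have : (0 : ℝ) < η ^ 2 := by positivity
      nlinarith
    by_contra hcon
    nlinarith
  obtain ⟨T', hT', hone, hcard⟩ := exists_cover_of_linked_pairs hH hT hI ht'
    (hRK.trans (by nlinarith)) hRt hRt' (by
      rw [Nat.cast_choose_two] at hpairs
      have h1 : 4 * ((K : ℝ) * T.card) < η * (T.card - 1) * T.card + 4 * T.card := by nlinarith
      have h2 : η * ((T.card : ℝ) - 1) * T.card =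
          2 * η * ((T.card : ℝ) * (T.card - 1) / 2) := by ring
      have h3 := h1.trans_le (add_le_add (h2.le.trans hpairs) le_rfl)
      exact_mod_cast h3)
  refine ⟨T', hT', ⟨1, hone⟩, ?_⟩
  rw [hcard]
  push_cast
  linarith
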